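/- Let f : [0,∞) → [0,∞) be a continuous function with compact support such that f(0) = 0. Then the metric space (T_f, d_f) is an ℝ-tree: for every pair of points σ₁, σ₂ ∈ T_f, (1) there is a unique isometric map φ : [0, d_f(σ₁,σ₂)] → T_f with φ(0) = σ₁ and φ(d_f(σ₁,σ₂)) = σ₂, and (2) every continuous injective map g : [0,1] → T_f with g(0) = σ₁ and g(1) = σ₂ satisfies g([0,1]) = φ([0, d_f(σ₁,σ₂)]). -/

import Mathlib

open scoped NNReal

noncomputable section

/-- The pseudo-distance `d_f (s,t) = f s + f t - 2 inf_{u ∈ [s ∧ t, s ∨ t]} f u`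
associated to a coding function `f : [0,∞) → [0,∞)`. -/
def treeDist (f : ℝ≥0 → ℝ) (s t : ℝ≥0) : ℝ :=
  f s + f t - 2 * sInf (f '' Set.Icc (min s t) (max s t))

section FourPoint

variable {T : Type*} [MetricSpace T]

/-- In a 0-hyperbolic space, a preconnected set contains every point lying metrically between
two of its points. -/
theorem IsPreconnected.mem_of_dist_add_eq
    (h4 : ∀ x y z w : T, dist x y + dist z w ≤ max (dist x z + dist y w) (dist x w + dist y z))
    {S : Set T} (hS : IsPreconnected S) {a b z : T} (ha : a ∈ S) (hb : b ∈ S)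
    (hz : dist a z + dist z b = dist a b) : z ∈ S := by
  by_contra hzS
  have hpos : ∀ x ∈ S, 0 < dist z x := fun x hx =>
    dist_pos.2 fun h => hzS (h ▸ hx)
  have hU : IsOpen {x | dist a x < dist a z + dist z x} :=
    isOpen_lt (by fun_prop) (by fun_prop)
  have hV : IsOpen {x | 0 < dist z x ∧ dist a z + dist z x ≤ dist a x} := by
    refine Metric.isOpen_iff.2 fun x hx => ⟨dist z x, hx.1, fun y hy => ?_⟩
    obtain ⟨hx0, hx1⟩ := hx
    rw [Metric.mem_ball, dist_comm] at hy
    have hzy : 0 < dist z y := by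
      linarith [dist_triangle z y x, dist_comm y x]
    refine ⟨hzy, ?_⟩
    rcases le_max_iff.1 (h4 a x z y) with h | h
    · linarith
    · linarith [dist_comm x z]
  obtain ⟨x, -, hxU, hxV⟩ := hS _ _ hU hV
    (fun x hx => (lt_or_ge (dist a x) (dist a z + dist z x)).imp id fun h => ⟨hpos x hx, h⟩)
    ⟨a, ha, by
      have := hpos a ha
      rw [Set.mem_ofPred_eq, dist_self, dist_comm a z]
      linarith⟩
    ⟨b, hb, hpos b hb, hz.le⟩
  exact absurd hxU (not_lt.2 hxV.2)

/-- A 0-hyperbolic space in which any two points are joined by a metric segment is an `ℝ`-tree. -/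
theorem exists_unique_segment_of_fourPoint
    (h4 : ∀ x y z w : T, dist x y + dist z w ≤ max (dist x z + dist y w) (dist x w + dist y z))
    (hgeo : ∀ (a b : T) (r : ℝ), 0 ≤ r → r ≤ dist a b →
      ∃ z, dist a z = r ∧ dist z b = dist a b - r) (a b : T) :
    ∃ φ : Set.Icc (0 : ℝ) (dist a b) → T,
      (Isometry φ ∧ φ ⟨0, le_refl 0, dist_nonneg⟩ = a ∧
          φ ⟨dist a b, dist_nonneg, le_refl _⟩ = b) ∧
      (∀ ψ : Set.Icc (0 : ℝ) (dist a b) → T,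
        Isometry ψ → ψ ⟨0, le_refl 0, dist_nonneg⟩ = a →
          ψ ⟨dist a b, dist_nonneg, le_refl _⟩ = b → ψ = φ) ∧
      (∀ g : Set.Icc (0 : ℝ) 1 → T, Continuous g → Function.Injective g →
        g ⟨0, le_refl 0, zero_le_one⟩ = a → g ⟨1, zero_le_one, le_refl 1⟩ = b →
          Set.range g = Set.range φ) := by
  choose φ hφa hφb using fun r : Set.Icc (0 : ℝ) (dist a b) => hgeo a b r r.2.1 r.2.2
  have huniq : ∀ (r : Set.Icc (0 : ℝ) (dist a b)) (x : T), dist a x = r →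
      dist x b = dist a b - r → x = φ r := fun r x hxa hxb => by
    refine dist_le_zero.1 ?_
    rcases le_max_iff.1 (h4 x (φ r) a b) with h | h <;>
      linarith [hφa r, hφb r, dist_comm x a, dist_comm (φ r) a]
  have hiso : Isometry φ := by
    refine Isometry.of_dist_eq fun r s => ?_
    rw [Subtype.dist_eq, Real.dist_eq]
    refine le_antisymm ?_ ?_
    · rcases le_max_iff.1 (h4 (φ r) (φ s) a b) with h | h
      · linarith [hφa r, hφb s, dist_comm (φ r) a, le_abs_self ((r : ℝ) - s)]
      · linarith [hφa s, hφb r, dist_comm (φ s) a, neg_abs_le ((r : ℝ) - s)]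
    · rw [abs_le']
      constructor
      · linarith [hφa r, hφa s, dist_triangle a (φ s) (φ r), dist_comm (φ s) (φ r)]
      · linarith [hφa r, hφa s, dist_triangle a (φ r) (φ s)]
  refine ⟨φ, ⟨hiso, ?_, ?_⟩, fun ψ hψ h0 h1 => ?_, fun g hg hinj h0 h1 => ?_⟩
  · exact (dist_eq_zero.1 (hφa _)).symm
  · exact dist_eq_zero.1 ((hφb _).trans (sub_self _))
  · funext r
    refine huniq r _ ?_ ?_
    · rw [← congrArg (dist · (ψ r)) h0, hψ.dist_eq, Subtype.dist_eq, Real.dist_eq, zero_sub,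
        abs_neg, abs_of_nonneg r.2.1]
    · rw [← congrArg (dist (ψ r)) h1, hψ.dist_eq, Subtype.dist_eq, Real.dist_eq, abs_sub_comm,
        abs_of_nonneg (sub_nonneg.2 r.2.2)]
  · refine Set.Subset.antisymm ?_ ?_
    · rintro _ ⟨τ, rfl⟩
      set x := g τ with hx
      have hr0 : 0 ≤ (dist a x + dist a b - dist x b) / 2 := by
        linarith [dist_triangle x a b, dist_comm x a]
      have hr1 : (dist a x + dist a b - dist x b) / 2 ≤ dist a b := by
        linarith [dist_triangle a b x, dist_comm x b]
      obtain ⟨z, hz⟩ : ∃ z, z = φ ⟨_, hr0, hr1⟩ := ⟨_, rfl⟩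
      have hza : dist a z = (dist a x + dist a b - dist x b) / 2 := hz ▸ hφa _
      have hzb : dist z b = dist a b - (dist a x + dist a b - dist x b) / 2 := hz ▸ hφb _
      have hzx : dist z x ≤ (dist a x + dist x b - dist a b) / 2 := by
        rcases le_max_iff.1 (h4 z x a b) with h | h <;>
          linarith [dist_comm z a, dist_comm x a]
      have hz₁ : z ∈ g '' Set.Iic τ := by
        refine (isPreconnected_Iic.image g hg.continuousOn).mem_of_dist_add_eq h4
          (a := a) (b := x) ⟨_, ?_, h0⟩ ⟨τ, Set.self_mem_Iic, rfl⟩ ?_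
        · exact τ.2.1
        · linarith [dist_triangle a z x]
      have hz₂ : z ∈ g '' Set.Ici τ := by
        refine (isPreconnected_Ici.image g hg.continuousOn).mem_of_dist_add_eq h4
          (a := x) (b := b) ⟨τ, Set.self_mem_Ici, rfl⟩ ⟨_, ?_, h1⟩ ?_
        · exact τ.2.2
        · linarith [dist_triangle x z b, dist_comm x z]
      obtain ⟨u, hu, hgu⟩ := hz₁
      obtain ⟨v, hv, hgv⟩ := hz₂
      obtain rfl : u = v := hinj (hgu.trans hgv.symm)
      obtain rfl : u = τ := le_antisymm hu hv
      exact ⟨_, (hgu.trans hz).symm⟩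
    · rintro _ ⟨r, rfl⟩
      exact (isPreconnected_range hg).mem_of_dist_add_eq h4 ⟨_, h0⟩ ⟨_, h1⟩
        (by linarith [hφa r, hφb r])

end FourPoint

section CodingFunction

variable {f : ℝ≥0 → ℝ}

theorem sInf_image_uIcc_le (hfpos : ∀ t, 0 ≤ f t) {s t u : ℝ≥0} (hu : u ∈ Set.uIcc s t) :
    sInf (f '' Set.uIcc s t) ≤ f u :=
  csInf_le ⟨0, by rintro _ ⟨x, -, rfl⟩; exact hfpos x⟩ ⟨u, hu, rfl⟩

theorem min_sInf_image_uIcc_le (hfpos : ∀ t, 0 ≤ f t) (s t u : ℝ≥0) :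
    min (sInf (f '' Set.uIcc s u)) (sInf (f '' Set.uIcc u t)) ≤ sInf (f '' Set.uIcc s t) := by
  refine le_csInf (Set.nonempty_uIcc.image f) ?_
  rintro _ ⟨x, hx, rfl⟩
  rcases Set.uIcc_subset_uIcc_union_uIcc (b := u) hx with h | h
  · exact min_le_of_left_le (sInf_image_uIcc_le hfpos h)
  · exact min_le_of_right_le (sInf_image_uIcc_le hfpos h)

/-- The 0-hyperbolicity inequality, for the Gromov products of four points. -/
theorem min_add_le_add_of_ultrametric {α : Type*} {m : α → α → ℝ} (hsymm : ∀ x y, m x y = m y x)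
    (hm : ∀ x y z, min (m x z) (m z y) ≤ m x y) (x y z w : α) :
    min (m x z + m y w) (m x w + m y z) ≤ m x y + m z w := by
  have h₁ := hm x y z
  have h₂ := hm x y w
  have h₃ := hm z w x
  have h₄ := hm z w y
  have h₅ := hm x z y
  have h₆ := hm x w y
  have h₇ := hm x z w
  have h₈ := hm x w z
  have h₉ := hm y w x
  have h₁₀ := hm y w z
  have h₁₁ := hm y z x
  have h₁₂ := hm y z w
  rw [hsymm z y, hsymm w y, hsymm z x, hsymm w z, hsymm y x] at *
  grind

theorem treeDist_fourPoint (hfpos : ∀ t, 0 ≤ f t) (x y z w : ℝ≥0) :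
    treeDist f x y + treeDist f z w ≤
      max (treeDist f x z + treeDist f y w) (treeDist f x w + treeDist f y z) := by
  have h := min_add_le_add_of_ultrametric (m := fun s t => sInf (f '' Set.uIcc s t))
    (fun s t => by rw [Set.uIcc_comm]) (min_sInf_image_uIcc_le hfpos) x y z w
  simp only [Set.uIcc] at h
  simp only [treeDist]
  rcases min_le_iff.1 h with h | h
  · exact le_max_of_le_left (by linarith)
  · exact le_max_of_le_right (by linarith)

/-- The first point, going from `s` towards `t`, at which `f` takes the value `c`. -/
theorem exists_first_hit (hcont : Continuous f) (hfpos : ∀ t, 0 ≤ f t) {s t : ℝ≥0} {c : ℝ}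
    (hc : sInf (f '' Set.uIcc s t) ≤ c) (hcs : c ≤ f s) :
    ∃ x, f x = c ∧ sInf (f '' Set.uIcc s x) = c := by
  have hK : IsCompact (Set.uIcc s t) := isCompact_uIcc
  obtain ⟨v, hv, hfv⟩ := hK.exists_sInf_image_eq Set.nonempty_uIcc hcont.continuousOn
  obtain ⟨x, ⟨hxt, hxc⟩, hx⟩ :=
    (hK.inter_right (isClosed_le hcont continuous_const : IsClosed {y | f y ≤ c})).exists_isMinOn
      ⟨v, hv, hfv.symm.trans_le hc⟩ (f := fun y => dist y s) (by fun_prop)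
  have hlt : ∀ y ∈ Set.uIcc s x, f y ≤ c → y = x := fun y hy hyc => by
    have hd : dist x s ≤ dist y s :=
      hx ⟨Set.uIcc_subset_uIcc Set.left_mem_uIcc hxt hy, hyc⟩
    rw [NNReal.dist_eq, NNReal.dist_eq] at hd
    rcases le_total s x with h | h
    · rw [Set.uIcc_of_le h] at hy
      refine le_antisymm hy.2 (NNReal.coe_le_coe.1 ?_)
      rw [abs_of_nonneg (sub_nonneg.2 (NNReal.coe_le_coe.2 h)),
        abs_of_nonneg (sub_nonneg.2 (NNReal.coe_le_coe.2 hy.1))] at hd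
      linarith
    · rw [Set.uIcc_of_ge h] at hy
      refine le_antisymm (NNReal.coe_le_coe.1 ?_) hy.1
      rw [abs_of_nonpos (sub_nonpos.2 (NNReal.coe_le_coe.2 h)),
        abs_of_nonpos (sub_nonpos.2 (NNReal.coe_le_coe.2 hy.2))] at hd
      linarith
  have hfx : f x = c := by
    obtain ⟨y, hy, hyc⟩ := intermediate_value_uIcc (a := s) (b := x) hcont.continuousOn
      (Set.mem_uIcc.2 (Or.inr ⟨hxc, hcs⟩))
    rw [← hlt y hy hyc.le, hyc]
  refine ⟨x, hfx, le_antisymm ?_ (le_csInf (Set.nonempty_uIcc.image f) ?_)⟩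
  · exact hfx ▸ sInf_image_uIcc_le hfpos Set.right_mem_uIcc
  · rintro _ ⟨y, hy, rfl⟩
    by_contra! h
    rw [hlt y hy h.le, hfx] at h
    exact h.false

theorem treeDist_comm (s t : ℝ≥0) : treeDist f s t = treeDist f t s := by
  simp only [treeDist, min_comm s t, max_comm s t]
  ring

theorem exists_treeDist_eq_of_le_sub (hcont : Continuous f) (hfpos : ∀ t, 0 ≤ f t) {s t : ℝ≥0}
    {r : ℝ} (hr : 0 ≤ r) (hrs : r ≤ f s - sInf (f '' Set.uIcc s t)) :
    ∃ x, treeDist f s x = r ∧ treeDist f x t = treeDist f s t - r := by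
  obtain ⟨x, hfx, hsx⟩ := exists_first_hit (c := f s - r) hcont hfpos (by linarith) (by linarith)
  have hxt : sInf (f '' Set.uIcc x t) = sInf (f '' Set.uIcc s t) := by
    have h₁ := min_sInf_image_uIcc_le hfpos s t x
    have h₂ := min_sInf_image_uIcc_le hfpos x t s
    rw [Set.uIcc_comm x s] at h₂
    rw [hsx] at h₁ h₂
    rw [min_eq_right (hfx ▸ sInf_image_uIcc_le hfpos Set.left_mem_uIcc)] at h₁
    rw [min_eq_right (by linarith)] at h₂
    exact le_antisymm h₁ h₂
  simp only [Set.uIcc] at hsx hxt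
  refine ⟨x, ?_, ?_⟩ <;> simp only [treeDist]
  · change f s + f x - 2 * sInf (f '' Set.Icc (s ⊓ x) (s ⊔ x)) = r
    linarith
  · change f x + f t - 2 * sInf (f '' Set.Icc (x ⊓ t) (x ⊔ t)) =
      f s + f t - 2 * sInf (f '' Set.Icc (s ⊓ t) (s ⊔ t)) - r
    linarith

theorem exists_treeDist_eq (hcont : Continuous f) (hfpos : ∀ t, 0 ≤ f t) (s t : ℝ≥0)
    {r : ℝ} (hr : 0 ≤ r) (hrt : r ≤ treeDist f s t) :
    ∃ x, treeDist f s x = r ∧ treeDist f x t = treeDist f s t - r := by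
  rcases le_total r (f s - sInf (f '' Set.uIcc s t)) with h | h
  · exact exists_treeDist_eq_of_le_sub hcont hfpos hr h
  · have hd : treeDist f s t = f s + f t - 2 * sInf (f '' Set.uIcc s t) := rfl
    obtain ⟨x, hx₁, hx₂⟩ := exists_treeDist_eq_of_le_sub (s := t) (t := s)
      (r := treeDist f s t - r) hcont hfpos (by linarith) (by rw [Set.uIcc_comm]; linarith)
    refine ⟨x, ?_, ?_⟩
    · rw [treeDist_comm s x, hx₂, treeDist_comm t s, sub_sub_cancel]
    · rw [treeDist_comm x t, hx₁]

end CodingFunction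

/-- the metric space `(T_f, d_f)` (i.e. any metric space `T` together with
a surjection `p : [0,∞) → T` such that `dist (p s) (p t) = d_f(s,t)`) is an ℝ-tree:
for any `σ₁ σ₂ : T` there is a unique isometric map `φ : [0, dist σ₁ σ₂] → T` with
`φ 0 = σ₁` and `φ (dist σ₁ σ₂) = σ₂`, and moreover every continuous injective map
`g : [0,1] → T` with `g 0 = σ₁`, `g 1 = σ₂` has range equal to that of `φ`. -/
theorem treeSpace_isRTree (f : ℝ≥0 → ℝ) (hcont : Continuous f)
    (hsupp : HasCompactSupport f) (hf0 : f 0 = 0) (hfpos : ∀ t, 0 ≤ f t)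
    (T : Type) [MetricSpace T] (p : ℝ≥0 → T) (hsurj : Function.Surjective p)
    (hdist : ∀ s t, dist (p s) (p t) = treeDist f s t) (σ₁ σ₂ : T) :
    ∃ φ : Set.Icc (0 : ℝ) (dist σ₁ σ₂) → T,
      (Isometry φ ∧ φ ⟨0, le_refl 0, dist_nonneg⟩ = σ₁ ∧
          φ ⟨dist σ₁ σ₂, dist_nonneg, le_refl _⟩ = σ₂) ∧
      (∀ ψ : Set.Icc (0 : ℝ) (dist σ₁ σ₂) → T,
        Isometry ψ → ψ ⟨0, le_refl 0, dist_nonneg⟩ = σ₁ →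
          ψ ⟨dist σ₁ σ₂, dist_nonneg, le_refl _⟩ = σ₂ → ψ = φ) ∧
      (∀ g : Set.Icc (0 : ℝ) 1 → T, Continuous g → Function.Injective g →
        g ⟨0, le_refl 0, zero_le_one⟩ = σ₁ → g ⟨1, zero_le_one, le_refl 1⟩ = σ₂ →
          Set.range g = Set.range φ) := by
  refine exists_unique_segment_of_fourPoint ?_ ?_ σ₁ σ₂
  · intro x y z w
    obtain ⟨x, rfl⟩ := hsurj x
    obtain ⟨y, rfl⟩ := hsurj y
    obtain ⟨z, rfl⟩ := hsurj z
    obtain ⟨w, rfl⟩ := hsurj w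
    simpa only [hdist] using treeDist_fourPoint hfpos x y z w
  · intro a b r hr hrt
    obtain ⟨s, rfl⟩ := hsurj a
    obtain ⟨t, rfl⟩ := hsurj b
    rw [hdist] at hrt
    obtain ⟨x, hx⟩ := exists_treeDist_eq hcont hfpos s t hr hrt
    exact ⟨p x, by simpa only [hdist] using hx⟩
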